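/- Let W be a linear subspace of V = K^{2k} of dimension k' with k' ≤ k, and let W' be any linear subspace of V. Then there exists C ∈ B with C(W) = W' if and only if I_{W'} = I_W. In other words, the B-orbit of W is exactly the set of all subspaces W' of V with I_{W'} = I_W. -/

import Mathlib

/-- `F_i`: the span of the first `i` standard basis vectors of `K^n`. -/
noncomputable def Fsub (K : Type*) [Field K] (n i : ℕ) : Submodule K (Fin n → K) :=
  Submodule.span K ((fun t : Fin n => Pi.single t (1 : K)) '' { t : Fin n | (t : ℕ) < i })

/-- `G_j`: the span of the standard basis vectors of `K^n` with indices `k, …, k+j-1`. -/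
noncomputable def Gsub (K : Type*) [Field K] (n k j : ℕ) : Submodule K (Fin n → K) :=
  Submodule.span K
    ((fun t : Fin n => Pi.single t (1 : K)) '' { t : Fin n | k ≤ (t : ℕ) ∧ (t : ℕ) < k + j })

/-- The `(i,j)` entry of the incidence matrix of a subspace `W ⊆ K^n`:
`dim_K (W ∩ (F_i + G_j))`. -/
noncomputable def incidence (K : Type*) [Field K] (n k : ℕ)
    (W : Submodule K (Fin n → K)) (i j : ℕ) : ℕ :=
  Module.finrank K ↥(W ⊓ (Fsub K n i ⊔ Gsub K n k j))

/-- The group `B` of invertible `2k × 2k` matrices that are block-diagonal with two `k × k`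
upper-triangular diagonal blocks: all entries below the diagonal, and all entries in the
off-diagonal blocks, vanish. -/
def memB (K : Type*) [Field K] (k : ℕ) (C : Matrix (Fin (2*k)) (Fin (2*k)) K) : Prop :=
  IsUnit C ∧ ∀ i j : Fin (2*k),
    ((j : ℕ) < (i : ℕ) ∨ ((i : ℕ) < k ∧ k ≤ (j : ℕ))) → C i j = 0

section Orbits

variable {K : Type*} [Field K] {k : ℕ}

/-- The coordinate subspace `F_a + G_b`, described by the vanishing of coordinates. -/
def flagSum (K : Type*) [Field K] (k a b : ℕ) : Submodule K (Fin (2 * k) → K) where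
  carrier := {x | ∀ t : Fin (2 * k), (((t : ℕ) < k ∧ a ≤ (t : ℕ)) ∨ k + b ≤ (t : ℕ)) → x t = 0}
  add_mem' := fun hx hy t ht => by simp [hx t ht, hy t ht]
  zero_mem' := fun _ _ => rfl
  smul_mem' := fun c x hx t ht => by simp [hx t ht]

theorem mem_flagSum {a b : ℕ} {x : Fin (2 * k) → K} :
    x ∈ flagSum K k a b ↔
      ∀ t : Fin (2 * k), (((t : ℕ) < k ∧ a ≤ (t : ℕ)) ∨ k + b ≤ (t : ℕ)) → x t = 0 :=
  Iff.rfl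

theorem Fsub_sup_Gsub {a b : ℕ} (ha : a ≤ k) :
    Fsub K (2 * k) a ⊔ Gsub K (2 * k) k b = flagSum K k a b := by
  have hb : (fun t : Fin (2 * k) => (Pi.single t (1 : K) : Fin (2 * k) → K)) =
      Pi.basisFun K (Fin (2 * k)) := by
    ext t; simp
  unfold Fsub Gsub
  rw [← Submodule.span_union, ← Set.image_union, hb]
  ext x
  rw [Module.Basis.mem_span_image, mem_flagSum]
  simp only [Set.subset_def, Finset.mem_coe, Finsupp.mem_support_iff, Pi.basisFun_repr,
    Set.mem_union, Set.mem_ofPred_eq]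
  refine forall_congr' fun t => ?_
  rw [← not_imp_not, not_not]
  refine imp_congr ?_ Iff.rfl
  omega

theorem incidence_eq {a b : ℕ} (ha : a ≤ k) (W : Submodule K (Fin (2 * k) → K)) :
    incidence K (2 * k) k W a b = Module.finrank K ↥(W ⊓ flagSum K k a b) := by
  rw [incidence, Fsub_sup_Gsub ha]

theorem flagSum_mono {a b a' b' : ℕ} (ha : a ≤ a') (hb : b ≤ b') :
    flagSum K k a b ≤ flagSum K k a' b' :=
  fun _ hx t ht => hx t (by omega)

theorem flagSum_inf (a b : ℕ) :
    flagSum K k a (b + 1) ⊓ flagSum K k (a + 1) b = flagSum K k a b := by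
  refine le_antisymm (fun x hx t ht => ?_)
    (le_inf (flagSum_mono le_rfl (by omega)) (flagSum_mono (by omega) le_rfl))
  rcases ht with ht | ht
  · exact hx.1 t (Or.inl ht)
  · exact hx.2 t (Or.inr ht)

theorem flagSum_zero_zero : flagSum K k 0 0 = ⊥ := by
  refine (Submodule.eq_bot_iff _).2 fun x hx => funext fun t => hx t (by omega)

theorem mem_flagSum_of_left {a b : ℕ} (ha : a < k) {x : Fin (2 * k) → K}
    (hx : x ∈ flagSum K k (a + 1) b) (h0 : x ⟨a, by omega⟩ = 0) : x ∈ flagSum K k a b := by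
  intro t ht
  by_cases hta : (t : ℕ) = a
  · rwa [show t = ⟨a, by omega⟩ from Fin.ext hta]
  · exact hx t (by omega)

theorem mem_flagSum_of_right {a b : ℕ} (hb : b < k) {x : Fin (2 * k) → K}
    (hx : x ∈ flagSum K k a (b + 1)) (h0 : x ⟨k + b, by omega⟩ = 0) :
    x ∈ flagSum K k a b := by
  intro t ht
  by_cases htb : (t : ℕ) = k + b
  · rwa [show t = ⟨k + b, by omega⟩ from Fin.ext htb]
  · exact hx t (by omega)

/-- The part of `W ∩ (F_a + G_b)` generated by the preceding members of the bifiltration. -/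
def prevPart (W : Submodule K (Fin (2 * k) → K)) : ℕ → ℕ → Submodule K (Fin (2 * k) → K)
  | 0, 0 => ⊥
  | a + 1, 0 => W ⊓ flagSum K k a 0
  | 0, b + 1 => W ⊓ flagSum K k 0 b
  | a + 1, b + 1 => (W ⊓ flagSum K k a (b + 1)) ⊔ (W ⊓ flagSum K k (a + 1) b)

/-- `(a, b)` is a jump of `W` if `W ∩ (F_a + G_b)` is not generated by the preceding members
of the bifiltration. -/
def IsJump (W : Submodule K (Fin (2 * k) → K)) (a b : ℕ) : Prop :=
  a ≤ k ∧ b ≤ k ∧ prevPart W a b ≠ W ⊓ flagSum K k a b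

variable {W W' : Submodule K (Fin (2 * k) → K)}

theorem prevPart_le (a b : ℕ) : prevPart W a b ≤ W ⊓ flagSum K k a b := by
  rcases a with - | a <;> rcases b with - | b
  · exact bot_le
  · exact inf_le_inf_left _ (flagSum_mono le_rfl (by omega))
  · exact inf_le_inf_left _ (flagSum_mono (by omega) le_rfl)
  · exact sup_le (inf_le_inf_left _ (flagSum_mono (by omega) le_rfl))
      (inf_le_inf_left _ (flagSum_mono le_rfl (by omega)))

theorem le_prevPart_left (a b : ℕ) : W ⊓ flagSum K k a b ≤ prevPart W (a + 1) b := by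
  rcases b with - | b
  · exact le_rfl
  · exact le_sup_left

theorem le_prevPart_right (a b : ℕ) : W ⊓ flagSum K k a b ≤ prevPart W a (b + 1) := by
  rcases a with - | a
  · exact le_rfl
  · exact le_sup_right

theorem prevPart_le_of {N : Submodule K (Fin (2 * k) → K)} {a b : ℕ}
    (hl : ∀ a', a = a' + 1 → W ⊓ flagSum K k a' b ≤ N)
    (hr : ∀ b', b = b' + 1 → W ⊓ flagSum K k a b' ≤ N) : prevPart W a b ≤ N := by
  rcases a with - | a <;> rcases b with - | b
  · exact bot_le
  · exact hr b rfl
  · exact hl a rfl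
  · exact sup_le (hl a rfl) (hr b rfl)

theorem finrank_prevPart_eq
    (h : ∀ a b : ℕ, a ≤ k → b ≤ k → Module.finrank K ↥(W' ⊓ flagSum K k a b) =
      Module.finrank K ↥(W ⊓ flagSum K k a b)) {a b : ℕ} (ha : a ≤ k) (hb : b ≤ k) :
    Module.finrank K ↥(prevPart W' a b) = Module.finrank K ↥(prevPart W a b) := by
  rcases a with - | a <;> rcases b with - | b
  · rfl
  · exact h _ _ ha (by omega)
  · exact h _ _ (by omega) hb
  · have key : ∀ X : Submodule K (Fin (2 * k) → K),
        Module.finrank K ↥(prevPart X (a + 1) (b + 1)) +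
          Module.finrank K ↥(X ⊓ flagSum K k a b) =
        Module.finrank K ↥(X ⊓ flagSum K k a (b + 1)) +
          Module.finrank K ↥(X ⊓ flagSum K k (a + 1) b) := by
      intro X
      rw [← Submodule.finrank_sup_add_finrank_inf_eq (X ⊓ flagSum K k a (b + 1)),
        ← inf_inf_distrib_left, flagSum_inf]
      rfl
    have h1 := key W
    have h2 := key W'
    have e1 := h a b (by omega) (by omega)
    have e2 := h a (b + 1) (by omega) hb
    have e3 := h (a + 1) b ha (by omega)
    omega

theorem prevPart_eq_iff (a b : ℕ) : prevPart W a b = W ⊓ flagSum K k a b ↔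
    Module.finrank K ↥(prevPart W a b) = Module.finrank K ↥(W ⊓ flagSum K k a b) :=
  ⟨fun h => by rw [h], Submodule.eq_of_le_of_finrank_eq (prevPart_le a b)⟩

theorem isJump_iff
    (h : ∀ a b : ℕ, a ≤ k → b ≤ k → Module.finrank K ↥(W' ⊓ flagSum K k a b) =
      Module.finrank K ↥(W ⊓ flagSum K k a b)) (a b : ℕ) :
    IsJump W' a b ↔ IsJump W a b := by
  refine and_congr_right fun ha => and_congr_right fun hb => not_congr ?_
  rw [prevPart_eq_iff, prevPart_eq_iff, finrank_prevPart_eq h ha hb, h a b ha hb]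

theorem apply_ne_zero_left {a b : ℕ} (ha : a < k) {e : Fin (2 * k) → K}
    (he : e ∈ W ⊓ flagSum K k (a + 1) b) (he' : e ∉ prevPart W (a + 1) b) :
    e ⟨a, by omega⟩ ≠ 0 :=
  fun h0 => he' (le_prevPart_left a b ⟨he.1, mem_flagSum_of_left ha he.2 h0⟩)

theorem apply_ne_zero_right {a b : ℕ} (hb : b < k) {e : Fin (2 * k) → K}
    (he : e ∈ W ⊓ flagSum K k a (b + 1)) (he' : e ∉ prevPart W a (b + 1)) :
    e ⟨k + b, by omega⟩ ≠ 0 :=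
  fun h0 => he' (le_prevPart_right a b ⟨he.1, mem_flagSum_of_right hb he.2 h0⟩)

theorem sub_smul_mem_left {a b : ℕ} (ha : a < k) {e w : Fin (2 * k) → K}
    (he : e ∈ W ⊓ flagSum K k (a + 1) b) (h0 : e ⟨a, by omega⟩ ≠ 0)
    (hw : w ∈ W ⊓ flagSum K k (a + 1) b) :
    w - (w ⟨a, by omega⟩ / e ⟨a, by omega⟩) • e ∈ W ⊓ flagSum K k a b := by
  have h := Submodule.sub_mem _ hw
    (Submodule.smul_mem _ (w ⟨a, by omega⟩ / e ⟨a, by omega⟩) he)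
  exact ⟨h.1, mem_flagSum_of_left ha h.2 (by simp [h0])⟩

theorem sub_smul_mem_right {a b : ℕ} (hb : b < k) {e w : Fin (2 * k) → K}
    (he : e ∈ W ⊓ flagSum K k a (b + 1)) (h0 : e ⟨k + b, by omega⟩ ≠ 0)
    (hw : w ∈ W ⊓ flagSum K k a (b + 1)) :
    w - (w ⟨k + b, by omega⟩ / e ⟨k + b, by omega⟩) • e ∈ W ⊓ flagSum K k a b := by
  have h := Submodule.sub_mem _ hw
    (Submodule.smul_mem _ (w ⟨k + b, by omega⟩ / e ⟨k + b, by omega⟩) he)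
  exact ⟨h.1, mem_flagSum_of_right hb h.2 (by simp [h0])⟩

theorem exists_of_isJump {a b : ℕ} (h : IsJump W a b) :
    ∃ e ∈ W ⊓ flagSum K k a b, e ∉ prevPart W a b :=
  SetLike.exists_of_lt (lt_of_le_of_ne (prevPart_le a b) h.2.2)

theorem not_isJump_of_lt_left {a b b' : ℕ} (h : IsJump W (a + 1) b) (hbb : b < b') :
    ¬ IsJump W (a + 1) b' := by
  intro h'
  obtain ⟨e, he, hne⟩ := exists_of_isJump h
  obtain ⟨w, hw, hnw⟩ := exists_of_isJump h'
  obtain ⟨c, rfl⟩ : ∃ c, b' = c + 1 := ⟨b' - 1, by omega⟩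
  have hak : a < k := h.1
  have h0 := apply_ne_zero_left hak he hne
  have he2 : e ∈ W ⊓ flagSum K k (a + 1) c := ⟨he.1, flagSum_mono le_rfl (by omega) he.2⟩
  have he3 : e ∈ W ⊓ flagSum K k (a + 1) (c + 1) :=
    ⟨he.1, flagSum_mono le_rfl (by omega) he.2⟩
  apply hnw
  rw [← sub_add_cancel w ((w ⟨a, by omega⟩ / e ⟨a, by omega⟩) • e)]
  exact Submodule.add_mem _ (le_prevPart_left _ _ (sub_smul_mem_left hak he3 h0 hw))
    (Submodule.smul_mem _ _ (le_prevPart_right _ _ he2))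

theorem not_isJump_of_lt_right {a a' b : ℕ} (h : IsJump W a (b + 1)) (haa : a < a') :
    ¬ IsJump W a' (b + 1) := by
  intro h'
  obtain ⟨e, he, hne⟩ := exists_of_isJump h
  obtain ⟨w, hw, hnw⟩ := exists_of_isJump h'
  obtain ⟨c, rfl⟩ : ∃ c, a' = c + 1 := ⟨a' - 1, by omega⟩
  have hbk : b < k := h.2.1
  have h0 := apply_ne_zero_right hbk he hne
  have he2 : e ∈ W ⊓ flagSum K k c (b + 1) := ⟨he.1, flagSum_mono (by omega) le_rfl he.2⟩
  have he3 : e ∈ W ⊓ flagSum K k (c + 1) (b + 1) :=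
    ⟨he.1, flagSum_mono (by omega) le_rfl he.2⟩
  apply hnw
  rw [← sub_add_cancel w ((w ⟨k + b, by omega⟩ / e ⟨k + b, by omega⟩) • e)]
  exact Submodule.add_mem _ (le_prevPart_right _ _ (sub_smul_mem_right hbk he3 h0 hw))
    (Submodule.smul_mem _ _ (le_prevPart_left _ _ he2))

theorem IsJump.right_unique {a b b' : ℕ} (h : IsJump W (a + 1) b) (h' : IsJump W (a + 1) b') :
    b = b' := by
  rcases lt_trichotomy b b' with hlt | heq | hlt
  · exact absurd h' (not_isJump_of_lt_left h hlt)
  · exact heq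
  · exact absurd h (not_isJump_of_lt_left h' hlt)

theorem IsJump.left_unique {a a' b : ℕ} (h : IsJump W a (b + 1)) (h' : IsJump W a' (b + 1)) :
    a = a' := by
  rcases lt_trichotomy a a' with hlt | heq | hlt
  · exact absurd h' (not_isJump_of_lt_right h hlt)
  · exact heq
  · exact absurd h (not_isJump_of_lt_right h' hlt)

theorem inf_flagSum_le_span {e : ℕ → ℕ → Fin (2 * k) → K}
    (he : ∀ a b, IsJump W a b → e a b ∈ W ⊓ flagSum K k a b ∧ e a b ∉ prevPart W a b) :
    ∀ a b : ℕ, a ≤ k → b ≤ k →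
      W ⊓ flagSum K k a b ≤ Submodule.span K {x | ∃ a b, IsJump W a b ∧ x = e a b}
  | 0, 0, _, _ => by rw [flagSum_zero_zero, inf_bot_eq]; exact bot_le
  | a + 1, b, ha, hb => by
    have ih := inf_flagSum_le_span he a b (by omega) hb
    by_cases hJ : IsJump W (a + 1) b
    · intro w hw
      obtain ⟨h1, h2⟩ := he _ _ hJ
      rw [← sub_add_cancel w ((w ⟨a, by omega⟩ / e (a + 1) b ⟨a, by omega⟩) • e (a + 1) b)]
      exact Submodule.add_mem _
        (ih (sub_smul_mem_left ha h1 (apply_ne_zero_left ha h1 h2) hw))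
        (Submodule.smul_mem _ _ (Submodule.subset_span ⟨_, _, hJ, rfl⟩))
    · have hp : prevPart W (a + 1) b = W ⊓ flagSum K k (a + 1) b := by
        by_contra hne
        exact hJ ⟨ha, hb, hne⟩
      rw [← hp]
      refine prevPart_le_of ?_ fun b' hb' => inf_flagSum_le_span he (a + 1) b' ha (by omega)
      rintro _ ⟨⟩
      exact ih
  | 0, b + 1, ha, hb => by
    have ih := inf_flagSum_le_span he 0 b ha (by omega)
    by_cases hJ : IsJump W 0 (b + 1)
    · intro w hw
      obtain ⟨h1, h2⟩ := he _ _ hJ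
      rw [← sub_add_cancel w
        ((w ⟨k + b, by omega⟩ / e 0 (b + 1) ⟨k + b, by omega⟩) • e 0 (b + 1))]
      exact Submodule.add_mem _
        (ih (sub_smul_mem_right hb h1 (apply_ne_zero_right hb h1 h2) hw))
        (Submodule.smul_mem _ _ (Submodule.subset_span ⟨_, _, hJ, rfl⟩))
    · have hp : prevPart W 0 (b + 1) = W ⊓ flagSum K k 0 (b + 1) := by
        by_contra hne
        exact hJ ⟨ha, hb, hne⟩
      rw [← hp]
      exact ih
  termination_by a b => a + b

theorem span_jumps_eq {e : ℕ → ℕ → Fin (2 * k) → K}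
    (he : ∀ a b, IsJump W a b → e a b ∈ W ⊓ flagSum K k a b ∧ e a b ∉ prevPart W a b) :
    Submodule.span K {x | ∃ a b, IsJump W a b ∧ x = e a b} = W := by
  refine le_antisymm (Submodule.span_le.2 ?_) ?_
  · rintro _ ⟨a, b, h, rfl⟩
    exact (he a b h).1.1
  · exact fun w hw => inf_flagSum_le_span he k k le_rfl le_rfl ⟨hw, fun t ht => by omega⟩

/-- The indicator vector `f_a + g_b`, where `f_0 = g_0 = 0`. -/
def pairVec (K : Type*) [Field K] (k a b : ℕ) : Fin (2 * k) → K := fun t =>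
  if ((t : ℕ) < k ∧ (t : ℕ) + 1 = a) ∨ (k ≤ (t : ℕ) ∧ (t : ℕ) + 1 = k + b) then 1 else 0

theorem memB_iff {C : Matrix (Fin (2 * k)) (Fin (2 * k)) K} :
    memB K k C ↔ IsUnit C ∧ C.BlockTriangular id ∧
      C.BlockTriangular (fun t => if (t : ℕ) < k then 1 else 0) := by
  refine and_congr_right fun _ => ⟨fun h => ⟨fun i j hij => h i j (Or.inl hij),
    fun i j hij => h i j (Or.inr ?_)⟩, fun h i j hij => hij.elim (fun hij => h.1 hij) fun hij =>
      h.2 (by simp [hij.1, hij.2])⟩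
  by_cases hi : (i : ℕ) < k <;> by_cases hj : (j : ℕ) < k <;> simp [hi, hj] at hij ⊢
  omega

theorem memB.mul {C D : Matrix (Fin (2 * k)) (Fin (2 * k)) K} (hC : memB K k C)
    (hD : memB K k D) : memB K k (C * D) := by
  rw [memB_iff] at *
  exact ⟨hC.1.mul hD.1, hC.2.1.mul hD.2.1, hC.2.2.mul hD.2.2⟩

theorem memB.inv {C : Matrix (Fin (2 * k)) (Fin (2 * k)) K} (hC : memB K k C) :
    memB K k C⁻¹ := by
  rw [memB_iff] at *
  have := hC.1.invertible
  exact ⟨(Matrix.isUnit_nonsing_inv_iff).2 hC.1,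
    Matrix.blockTriangular_inv_of_blockTriangular hC.2.1,
    Matrix.blockTriangular_inv_of_blockTriangular hC.2.2⟩

theorem memB_of_diag_ne_zero {C : Matrix (Fin (2 * k)) (Fin (2 * k)) K}
    (h : ∀ i j : Fin (2 * k), ((j : ℕ) < (i : ℕ) ∨ ((i : ℕ) < k ∧ k ≤ (j : ℕ))) → C i j = 0)
    (hd : ∀ i, C i i ≠ 0) : memB K k C := by
  refine ⟨?_, h⟩
  rw [Matrix.isUnit_iff_isUnit_det,
    Matrix.det_of_isUpperTriangular (fun i j hij => h i j (Or.inl hij)), isUnit_iff_ne_zero]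
  exact Finset.prod_ne_zero_iff.2 fun i _ => hd i

theorem memB.map_flagSum_le {C : Matrix (Fin (2 * k)) (Fin (2 * k)) K} (hC : memB K k C)
    (a b : ℕ) : Submodule.map (Matrix.toLin' C) (flagSum K k a b) ≤ flagSum K k a b := by
  rintro _ ⟨x, hx, rfl⟩ t ht
  rw [Matrix.toLin'_apply, Matrix.mulVec, dotProduct]
  refine Finset.sum_eq_zero fun j _ => ?_
  by_cases h : (j : ℕ) < (t : ℕ) ∨ ((t : ℕ) < k ∧ k ≤ (j : ℕ))
  · rw [hC.2 t j h, zero_mul]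
  · rw [hx j (by omega), mul_zero]

theorem memB.injective {C : Matrix (Fin (2 * k)) (Fin (2 * k)) K} (hC : memB K k C) :
    Function.Injective (Matrix.toLin' C) := by
  intro x y hxy
  exact Matrix.mulVec_injective_of_isUnit hC.1 hxy

theorem memB.finrank_map {C : Matrix (Fin (2 * k)) (Fin (2 * k)) K} (hC : memB K k C)
    (X : Submodule K (Fin (2 * k) → K)) :
    Module.finrank K ↥(Submodule.map (Matrix.toLin' C) X) = Module.finrank K ↥X :=
  (Submodule.equivMapOfInjective _ hC.injective X).finrank_eq.symm

theorem memB.map_flagSum {C : Matrix (Fin (2 * k)) (Fin (2 * k)) K} (hC : memB K k C)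
    (a b : ℕ) : Submodule.map (Matrix.toLin' C) (flagSum K k a b) = flagSum K k a b :=
  Submodule.eq_of_le_of_finrank_eq (hC.map_flagSum_le a b)
    (hC.finrank_map _)

/-- Normal form: every subspace is in the `B`-orbit of the span of the vectors `f_a + g_b`
attached to its jumps. -/
theorem exists_memB_map_span_pairVec (W : Submodule K (Fin (2 * k) → K)) :
    ∃ U, memB K k U ∧ Submodule.map (Matrix.toLin' U)
      (Submodule.span K {x | ∃ a b, IsJump W a b ∧ x = pairVec K k a b}) = W := by
  classical
  have h1 : ∀ a b, ∃ e, IsJump W a b → e ∈ W ⊓ flagSum K k a b ∧ e ∉ prevPart W a b := by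
    intro a b
    by_cases h : IsJump W a b
    · obtain ⟨e, h⟩ := exists_of_isJump h
      exact ⟨e, fun _ => h⟩
    · exact ⟨0, fun h' => absurd h' h⟩
  choose e he using h1
  have hu : ∀ a, ∃ u : Fin (2 * k) → K, ∀ ha : a < k, u ⟨a, by omega⟩ ≠ 0 ∧
      u ∈ flagSum K k (a + 1) 0 ∧
      ∀ b, IsJump W (a + 1) b → ∀ t : Fin (2 * k), (t : ℕ) < k → u t = e (a + 1) b t := by
    intro a
    by_cases h : ∃ b, IsJump W (a + 1) b
    · obtain ⟨b, hb⟩ := h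
      refine ⟨fun t => if (t : ℕ) < k then e (a + 1) b t else 0, fun ha => ⟨?_, ?_, ?_⟩⟩
      · simpa [ha] using apply_ne_zero_left ha (he _ _ hb).1 (he _ _ hb).2
      · intro t ht
        by_cases htk : (t : ℕ) < k
        · simpa [htk] using (he _ _ hb).1.2 t (by omega)
        · simp [htk]
      · intro b' hb' t ht
        rw [hb'.right_unique hb]
        exact if_pos ht
    · refine ⟨fun t => if (t : ℕ) = a then 1 else 0, fun ha => ⟨by simp, ?_, ?_⟩⟩
      · intro t ht
        exact if_neg (by omega)
      · exact fun b hb => absurd ⟨b, hb⟩ h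
  have hv : ∀ b, ∃ v : Fin (2 * k) → K, ∀ hb : b < k, v ⟨k + b, by omega⟩ ≠ 0 ∧
      v ∈ flagSum K k 0 (b + 1) ∧
      ∀ a, IsJump W a (b + 1) → ∀ t : Fin (2 * k), k ≤ (t : ℕ) → v t = e a (b + 1) t := by
    intro b
    by_cases h : ∃ a, IsJump W a (b + 1)
    · obtain ⟨a, ha⟩ := h
      refine ⟨fun t => if k ≤ (t : ℕ) then e a (b + 1) t else 0, fun hb => ⟨?_, ?_, ?_⟩⟩
      · simpa using apply_ne_zero_right hb (he _ _ ha).1 (he _ _ ha).2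
      · intro t ht
        by_cases htk : k ≤ (t : ℕ)
        · simpa [htk] using (he _ _ ha).1.2 t (by omega)
        · simp [htk]
      · intro a' ha' t ht
        rw [ha'.left_unique ha]
        exact if_pos ht
    · refine ⟨fun t => if (t : ℕ) = k + b then 1 else 0, fun hb => ⟨by simp, ?_, ?_⟩⟩
      · intro t ht
        exact if_neg (by omega)
      · exact fun a ha => absurd ⟨a, ha⟩ h
  choose u hu using hu
  choose v hv using hv
  let U : Matrix (Fin (2 * k)) (Fin (2 * k)) K := fun i j =>
    if (j : ℕ) < k then u j i else v (j - k) i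
  have hU1 : ∀ i j : Fin (2 * k), (j : ℕ) < k → U i j = u j i := fun i j h => if_pos h
  have hU2 : ∀ i j : Fin (2 * k), k ≤ (j : ℕ) → U i j = v (j - k) i :=
    fun i j h => if_neg (by omega)
  have hUs : ∀ a b, IsJump W a b → U.mulVec (pairVec K k a b) = e a b := by
    intro a b hab
    obtain ⟨hmem, -⟩ := he a b hab
    have ha := hab.1
    have hb := hab.2.1
    ext i
    rw [Matrix.mulVec, dotProduct]
    by_cases hi : (i : ℕ) < k
    · rcases a with - | a
      · rw [hmem.2 i (by omega)]
        refine Finset.sum_eq_zero fun j _ => ?_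
        by_cases hj : (j : ℕ) < k
        · rw [pairVec, if_neg (by omega), mul_zero]
        · rw [hU2 i j (by omega), (hv (j - k) (by omega)).2.1 i (by omega), zero_mul]
      · rw [Finset.sum_eq_single ⟨a, by omega⟩]
        · rw [pairVec, if_pos (Or.inl ⟨ha, rfl⟩), hU1 i ⟨a, by omega⟩ ha, mul_one]
          exact (hu a ha).2.2 b hab i hi
        · intro j _ hj
          have hj' : (j : ℕ) ≠ a := fun h => hj (Fin.ext h)
          by_cases hjk : (j : ℕ) < k
          · rw [pairVec, if_neg (by omega), mul_zero]
          · rw [hU2 i j (by omega), (hv (j - k) (by omega)).2.1 i (by omega), zero_mul]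
        · simp
    · rcases b with - | b
      · rw [hmem.2 i (by omega)]
        refine Finset.sum_eq_zero fun j _ => ?_
        by_cases hj : (j : ℕ) < k
        · rw [hU1 i j hj, (hu j hj).2.1 i (by omega), zero_mul]
        · rw [pairVec, if_neg (by omega), mul_zero]
      · rw [Finset.sum_eq_single ⟨k + b, by omega⟩]
        · rw [pairVec, if_pos (Or.inr ⟨by simp, by simp [add_assoc]⟩), hU2 _ _ (by simp),
            mul_one]
          simpa using (hv b hb).2.2 a hab i (by omega)
        · intro j _ hj
          have hj' : (j : ℕ) ≠ k + b := fun h => hj (Fin.ext h)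
          by_cases hjk : (j : ℕ) < k
          · rw [hU1 i j hjk, (hu j hjk).2.1 i (by omega), zero_mul]
          · rw [pairVec, if_neg (by omega), mul_zero]
        · simp
  refine ⟨U, memB_of_diag_ne_zero ?_ ?_, ?_⟩
  · intro i j hij
    by_cases hj : (j : ℕ) < k
    · rw [hU1 i j hj]
      exact (hu j hj).2.1 i (by omega)
    · rw [hU2 i j (by omega)]
      exact (hv (j - k) (by omega)).2.1 i (by omega)
  · intro i
    by_cases hi : (i : ℕ) < k
    · rw [hU1 i i hi]
      exact (hu i hi).1
    · rw [hU2 i i (by omega)]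
      have h := (hv (i - k) (by omega)).1
      rwa [show (⟨k + (i - k), by omega⟩ : Fin (2 * k)) = i from
        Fin.ext (by simp; omega)] at h
  · rw [Submodule.map_span]
    conv_rhs => rw [← span_jumps_eq he]
    congr 1
    ext x
    constructor
    · rintro ⟨_, ⟨a, b, h, rfl⟩, rfl⟩
      exact ⟨a, b, h, by rw [Matrix.toLin'_apply, hUs a b h]⟩
    · rintro ⟨a, b, h, rfl⟩
      exact ⟨_, ⟨a, b, h, rfl⟩, by rw [Matrix.toLin'_apply, hUs a b h]⟩

end Orbits

/-- **Corollary.** The `B`-orbit of a subspace of dimension `k' ≤ k` of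
`W ⊆ K^{2k}` is exactly the set of subspaces `W'` with the same incidence matrix as `W`. -/
theorem grass_k2k_orbits_lowdim (K : Type*) [Field K] (k k' : ℕ) (hk : 0 < k) (hk' : k' ≤ k)
    (W W' : Submodule K (Fin (2*k) → K)) (hW : Module.finrank K ↥W = k') :
    (∃ C : Matrix (Fin (2*k)) (Fin (2*k)) K, memB K k C ∧
        Submodule.map (Matrix.toLin' C) W = W') ↔
      (∀ i j : ℕ, i ≤ k → j ≤ k →
        incidence K (2*k) k W' i j = incidence K (2*k) k W i j) := by
  constructor
  · rintro ⟨C, hC, rfl⟩ i j hi -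
    rw [incidence_eq hi, incidence_eq hi]
    conv_lhs => rw [← hC.map_flagSum i j, ← Submodule.map_inf _ hC.injective]
    exact hC.finrank_map _
  · intro h
    have hJ := isJump_iff (W := W) (W' := W') fun a b ha hb => by
      rw [← incidence_eq ha, ← incidence_eq ha, h a b ha hb]
    obtain ⟨U, hU, hUW⟩ := exists_memB_map_span_pairVec W
    obtain ⟨U', hU', hUW'⟩ := exists_memB_map_span_pairVec W'
    simp only [hJ] at hUW'
    refine ⟨U' * U⁻¹, hU'.mul hU.inv, ?_⟩
    conv_lhs => rw [← hUW]
    rw [← Submodule.map_comp, ← Matrix.toLin'_mul, mul_assoc,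
      Matrix.nonsing_inv_mul _ ((Matrix.isUnit_iff_isUnit_det _).1 hU.1), mul_one, hUW']
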